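/- There exists γ*(d) > √(7d/4) such that for every γ ∈ (0, γ*(d)) there exists α₀ > γ with the property that for every α ∈ (γ, α₀) there is an H̄ ∈ (0, H₀) sufficiently small for which sup_{0<H≤H̄/2} sup_{A} E[(I^{H,H̄}_{α,γ}(A))²] < ∞, where the inner supremum runs over all Borel subsets A of D. -/

import Mathlib

open MeasureTheory ProbabilityTheory Filter Set

lemma exp_neg_le_quadratic {x : ℝ} (hx : 0 ≤ x) : Real.exp (-x) ≤ 1 - x + x ^ 2 / 2 := by
  have h := Real.quadratic_le_exp_of_nonneg hx
  have hp : 0 < 1 - x + x ^ 2 / 2 := by nlinarith [sq_nonneg (x - 1)]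
  have h1 : Real.exp (-x) * Real.exp x = 1 := by rw [← Real.exp_add]; simp
  have h2 := Real.exp_pos (-x)
  have h3 : 1 ≤ (1 - x + x ^ 2 / 2) * Real.exp x := by
    nlinarith [mul_le_mul_of_nonneg_left h hp.le, pow_nonneg hx 4]
  by_contra! hlt
  nlinarith [Real.exp_pos x, mul_lt_mul_of_pos_right hlt (Real.exp_pos x)]

lemma cubic_le_exp_neg {x : ℝ} (hx : 0 ≤ x) :
    1 - x + x ^ 2 / 2 - x ^ 3 / 6 ≤ Real.exp (-x) := by
  have hd (y : ℝ) : HasDerivAt (fun y => Real.exp (-y) - (1 - y + y ^ 2 / 2 - y ^ 3 / 6))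
      (-Real.exp (-y) - (-1 + y - y ^ 2 / 2)) y := by
    have h1 : HasDerivAt (fun y : ℝ => Real.exp (-y)) (Real.exp (-y) * (-1)) y :=
      (hasDerivAt_id y).neg.exp
    have h2 := ((((hasDerivAt_id y).const_sub 1).add ((hasDerivAt_pow 2 y).div_const 2)).sub
      ((hasDerivAt_pow 3 y).div_const 6))
    refine (h1.sub h2).congr_deriv ?_
    push_cast
    ring
  have hm : MonotoneOn (fun y => Real.exp (-y) - (1 - y + y ^ 2 / 2 - y ^ 3 / 6)) (Ici 0) := by
    refine monotoneOn_of_deriv_nonneg (convex_Ici 0)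
      (fun y _ => (hd y).continuousAt.continuousWithinAt)
      (fun y _ => (hd y).differentiableAt.differentiableWithinAt) fun y hy => ?_
    rw [(hd y).deriv]
    rw [interior_Ici] at hy
    linarith [exp_neg_le_quadratic (mem_Ioi.1 hy).le]
  have := hm (mem_Ici.2 le_rfl) (mem_Ici.2 hx) hx
  simp at this
  linarith

lemma exp_neg_one_bounds : 0.367879441 < Real.exp (-1) ∧ Real.exp (-1) < 0.367879442 := by
  have h1 : Real.exp (-1) * Real.exp 1 = 1 := by rw [← Real.exp_add]; simp
  have h2 := Real.exp_one_gt_d9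
  have h3 := Real.exp_one_lt_d9
  have h4 := Real.exp_pos (-1)
  constructor <;> by_contra! h <;> nlinarith

lemma one_sub_exp_neg_div_le {x : ℝ} (hx : 5 / 4 ≤ x) :
    (1 - Real.exp (-x)) / x ≤ 22857 / 40000 := by
  have h1 := exp_neg_one_bounds.1
  have h4 : 1 - (1 / 4 : ℝ) + (1 / 4) ^ 2 / 2 - (1 / 4) ^ 3 / 6 ≤ Real.exp (-(1 / 4)) :=
    cubic_le_exp_neg (by norm_num)
  have hp : 0.2862 ≤ Real.exp (-(5 / 4)) := by
    rw [show -(5 / 4 : ℝ) = -1 + -(1 / 4) by norm_num, Real.exp_add]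
    nlinarith
  have hp' : Real.exp (-(5 / 4)) ≤ 1 / 2 := by
    refine (Real.exp_le_exp.2 (by norm_num : -(5 / 4 : ℝ) ≤ -1)).trans ?_
    linarith [exp_neg_one_bounds.2]
  have he : Real.exp (-x) = Real.exp (-(5 / 4)) * Real.exp (-(x - 5 / 4)) := by
    rw [← Real.exp_add]; ring_nf
  have hl := Real.add_one_le_exp (-(x - 5 / 4))
  rw [div_le_iff₀ (by linarith), he]
  nlinarith [Real.exp_pos (-(5 / 4))]

/-- The rate of the tilted second moment at the optimal scale. -/
lemma tilted_rate_le {a b : ℝ} (ha : 0 < a) (ha' : a ≤ 5 / 8) (hb : 1 ≤ b) :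
    (1 - Real.exp (-(2 * a))) / (2 * a)
      - 2 * (339 / 500) * ((1 - Real.exp (-(2 * a + b))) / (2 * a + b))
      + (339 / 500) ^ 2 * ((2 - Real.exp (-(2 * (a + b)))) / (2 * (a + b)))
      ≤ 22857 / 40000 + 2 * (b - 1) := by
  obtain ⟨hq1, hq2⟩ := exp_neg_one_bounds
  set q := Real.exp (-1) with hq
  have T1 : (1 - Real.exp (-(2 * a))) / (2 * a) ≤ 1 - a + 2 * a ^ 2 / 3 := by
    rw [div_le_iff₀ (by linarith)]
    nlinarith [cubic_le_exp_neg (show 0 ≤ 2 * a by linarith)]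
  have T2 : (1 - q) - (1 - 2 * q) * (2 * a) - (b - 1)
      ≤ (1 - Real.exp (-(2 * a + b))) / (2 * a + b) := by
    have h1 : Real.exp (-(2 * a + b)) ≤ q * Real.exp (-(2 * a)) := by
      rw [hq, ← Real.exp_add]
      exact Real.exp_le_exp.2 (by linarith)
    have h2 := exp_neg_le_quadratic (show 0 ≤ 2 * a by linarith)
    rw [le_div_iff₀ (by linarith)]
    have h3 : Real.exp (-(2 * a + b)) ≤ q * (1 - 2 * a + (2 * a) ^ 2 / 2) :=
      h1.trans (mul_le_mul_of_nonneg_left h2 (by linarith))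
    have h4 : (1 - q) - (1 - 2 * q) * (2 * a) ≤ 1 := by nlinarith
    have h5 : ((1 - q) - (1 - 2 * q) * (2 * a) - (b - 1)) * (2 * a + b)
        ≤ ((1 - q) - (1 - 2 * q) * (2 * a)) * (2 * a + 1) := by
      nlinarith [mul_nonneg (show 0 ≤ b - 1 by linarith) (show 0 ≤ 2 * a + b - 1 by linarith),
        mul_nonneg (show 0 ≤ b - 1 by linarith) (sub_nonneg.2 h4)]
    nlinarith
  have T3 : (2 - Real.exp (-(2 * (a + b)))) / (2 * (a + b))
      ≤ 1 / 2 - 4 / 13 * a + (1 - q ^ 2) / 2 := by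
    have h1 : Real.exp (-(2 * (a + b))) = q ^ 2 * Real.exp (-(2 * (a + b) - 2)) := by
      rw [hq, ← Real.exp_nat_mul, ← Real.exp_add]; push_cast; ring_nf
    have h2 := Real.add_one_le_exp (-(2 * (a + b) - 2))
    have h3 : q ^ 2 * (1 - (2 * (a + b) - 2)) ≤ Real.exp (-(2 * (a + b))) := by
      rw [h1]; exact mul_le_mul_of_nonneg_left (by linarith) (sq_nonneg q)
    have h4 : 1 ≤ (1 / 2 - 4 / 13 * a) * (2 * (a + b)) := by nlinarith
    have h5 : q ^ 2 ≤ 1 / 5 := by nlinarith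
    rw [div_le_iff₀ (by linarith)]
    nlinarith [mul_nonneg (show 0 ≤ a + b - 1 by linarith) (show 0 ≤ 1 - 3 * q ^ 2 by linarith)]
  have h0 : 1 - 2 * (339 / 500) * (1 - q) + (339 / 500) ^ 2 * (2 - q ^ 2) / 2 ≤ 22857 / 40000 := by
    nlinarith
  have h1 : a * (-1 + 2 / 3 * a + 4 * (339 / 500) * (1 - 2 * q) - (339 / 500) ^ 2 * (4 / 13)) ≤ 0 :=
    mul_nonpos_of_nonneg_of_nonpos ha.le (by linarith)
  nlinarith

/-- The exponent of the tilted second moment at distance `exp (-t)`, with `a = H t`, `b = t / n`. -/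
lemma tilted_exponent_le {a b t ε M γ α k v₁ v₂ w p₁ p₂ p₃ p₄ : ℝ}
    (hrate : (1 - Real.exp (-(2 * a))) / (2 * a)
      - 2 * (339 / 500) * ((1 - Real.exp (-(2 * a + b))) / (2 * a + b))
      + (339 / 500) ^ 2 * ((2 - Real.exp (-(2 * (a + b)))) / (2 * (a + b)))
      ≤ 22857 / 40000 + 2 * (b - 1))
    (ha : 0 < a) (hb : 1 ≤ b) (ht : 0 < t) (hε : 0 ≤ ε) (hγ : 0 < γ) (hα : γ ≤ α)
    (hk : k ≤ (1 + ε) * ((1 - Real.exp (-(2 * a))) / (2 * a / t)) + 2 * M)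
    (hv₁ : v₁ ≤ (1 + ε) * (1 / (2 * (a + b) / t)) + 2 * M)
    (hv₂ : v₂ ≤ (1 + ε) * (1 / (2 * (a + b) / t)) + 2 * M)
    (hw : w ≤ (1 + ε) * ((1 - Real.exp (-(2 * (a + b)))) / (2 * (a + b) / t)) + 2 * M)
    (hp₁ : (1 - ε) * (1 / ((2 * a + b) / t)) - 2 * M ≤ p₁)
    (hp₂ : (1 - ε) * (1 / ((2 * a + b) / t)) - 2 * M ≤ p₂)
    (hp₃ : (1 - ε) * ((1 - Real.exp (-(2 * a + b))) / ((2 * a + b) / t)) - 2 * M ≤ p₃)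
    (hp₄ : (1 - ε) * ((1 - Real.exp (-(2 * a + b))) / ((2 * a + b) / t)) - 2 * M ≤ p₄)
    {l : ℝ} (hl : l = γ * (339 / 500)) :
    γ ^ 2 * k + l ^ 2 / 2 * (v₁ + v₂ + 2 * w) - γ * l * (p₁ + p₂ + p₃ + p₄)
        + 2 * l * (α / ((2 * a + b) / t))
      ≤ t * (γ ^ 2 * (22857 / 40000 + 2 * (b - 1)) + ε * (γ ^ 2 + l ^ 2 + 4 * γ * l)
          + 2 * l * (α - γ)) + M * (2 * γ ^ 2 + 4 * l ^ 2 + 8 * γ * l) := by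
  have hl0 : 0 < l := by rw [hl]; positivity
  have e1 := Real.add_one_le_exp (-(2 * a))
  have e2 := Real.exp_pos (-(2 * a + b))
  have e3 := Real.exp_pos (-(2 * (a + b)))
  have c1 : (1 - Real.exp (-(2 * a))) / (2 * a) ≤ 1 := by
    rw [div_le_one (by linarith)]; linarith
  have c2 : (1 - Real.exp (-(2 * a + b))) / (2 * a + b) ≤ 1 := by
    rw [div_le_one (by linarith)]; linarith
  have c3 : (2 - Real.exp (-(2 * (a + b)))) / (2 * (a + b)) ≤ 1 := by
    rw [div_le_one (by linarith)]; linarith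
  have c4 : 1 / (2 * a + b) ≤ 1 := by
    rw [div_le_one (by linarith)]; linarith
  have q1 : (1 - Real.exp (-(2 * a))) / (2 * a / t)
      = t * ((1 - Real.exp (-(2 * a))) / (2 * a)) := by field_simp
  have q2 : (1 - Real.exp (-(2 * a + b))) / ((2 * a + b) / t)
      = t * ((1 - Real.exp (-(2 * a + b))) / (2 * a + b)) := by field_simp
  have q3 : (1 - Real.exp (-(2 * (a + b)))) / (2 * (a + b) / t) + 1 / (2 * (a + b) / t)
      = t * ((2 - Real.exp (-(2 * (a + b)))) / (2 * (a + b))) := by field_simp; ring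
  have q4 : 1 / ((2 * a + b) / t) = t * (1 / (2 * a + b)) := by field_simp
  have q5 : α / ((2 * a + b) / t) = t * (α * (1 / (2 * a + b))) := by field_simp
  rw [q1] at hk
  rw [q4] at hp₁ hp₂
  rw [q2] at hp₃ hp₄
  rw [q5]
  have hvw : v₁ + v₂ + 2 * w
      ≤ 2 * (1 + ε) * (t * ((2 - Real.exp (-(2 * (a + b)))) / (2 * (a + b)))) + 8 * M := by
    rw [← q3]; linarith
  set C1 := (1 - Real.exp (-(2 * a))) / (2 * a)
  set C2 := (1 - Real.exp (-(2 * a + b))) / (2 * a + b)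
  set C3 := (2 - Real.exp (-(2 * (a + b)))) / (2 * (a + b))
  set I := 1 / (2 * a + b)
  have s1 := mul_le_mul_of_nonneg_left hk (sq_nonneg γ)
  have s2 := mul_le_mul_of_nonneg_left hvw (by positivity : 0 ≤ l ^ 2 / 2)
  have hp : (1 - ε) * (2 * t * (I + C2)) - 8 * M ≤ p₁ + p₂ + p₃ + p₄ := by linarith
  have s3 := mul_le_mul_of_nonneg_left hp (by positivity : 0 ≤ γ * l)
  have r1 := mul_le_mul_of_nonneg_left hrate (by positivity : 0 ≤ t * γ ^ 2)
  have r2 := mul_le_mul_of_nonneg_left c1 (by positivity : 0 ≤ t * ε * γ ^ 2)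
  have r3 := mul_le_mul_of_nonneg_left c3 (by positivity : 0 ≤ t * ε * l ^ 2)
  have r4 := mul_le_mul_of_nonneg_left (add_le_add c4 c2) (by positivity : 0 ≤ t * ε * (2 * γ * l))
  have r5 := mul_le_mul_of_nonneg_left c4
    (mul_nonneg (by positivity : 0 ≤ t * (2 * l)) (sub_nonneg.2 hα))
  have r6 : t * γ ^ 2 * (C1 - 2 * (339 / 500) * C2 + (339 / 500) ^ 2 * C3)
      = t * (γ ^ 2 * C1 - 2 * γ * l * C2 + l ^ 2 * C3) := by rw [hl]; ring
  rw [r6] at r1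
  linarith

section moments

variable {Ω : Type*} [MeasurableSpace Ω] {P : Measure Ω}

lemma lintegral_exp_of_map_eq_gaussianReal [IsProbabilityMeasure P] {L : Ω → ℝ}
    (hL : Measurable L) {v : NNReal} (h : P.map L = gaussianReal 0 v) :
    ∫⁻ ω, ENNReal.ofReal (Real.exp (L ω)) ∂P
      = ENNReal.ofReal (Real.exp ((∫ ω, L ω ^ 2 ∂P) / 2)) := by
  have hv : ∫ ω, L ω ^ 2 ∂P = v := by
    have h1 := variance_fun_id_gaussianReal (μ := 0) (v := v)
    rw [variance_eq_integral (by fun_prop), integral_id_gaussianReal, ← h,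
      integral_map hL.aemeasurable (by fun_prop)] at h1
    simpa using h1
  have hm := mgf_gaussianReal h 1
  rw [mgf] at hm
  have hi : Integrable (fun ω => Real.exp (L ω)) P := by
    have := integrable_exp_mul_gaussianReal (μ := 0) (v := v) 1
    rw [← h, integrable_map_measure (by fun_prop) hL.aemeasurable] at this
    simpa [Function.comp_def] using this
  rw [← ofReal_integral_eq_lintegral_ofReal hi (ae_of_all _ fun _ => (Real.exp_pos _).le), hv]
  simpa using congrArg ENNReal.ofReal hm

lemma memLp_two_of_map_eq_gaussianReal {L : Ω → ℝ}
    (hL : Measurable L) {v : NNReal} (h : P.map L = gaussianReal 0 v) : MemLp L 2 P := by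
  have := memLp_id_gaussianReal (μ := 0) (v := v) 2
  rw [← h] at this
  simpa using (memLp_map_measure_iff (by fun_prop) hL.aemeasurable).1 this

lemma lintegral_exp_linearCombination [IsProbabilityMeasure P] {ι : Type*} [Fintype ι]
    [DecidableEq ι]
    {Y : ι → Ω → ℝ} (hY : ∀ i, Measurable (Y i))
    (hG : ∀ c : ι → ℝ, ∃ v : NNReal, P.map (fun ω => ∑ i, c i * Y i ω) = gaussianReal 0 v)
    (c : ι → ℝ) :
    ∫⁻ ω, ENNReal.ofReal (Real.exp (∑ i, c i * Y i ω)) ∂P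
      = ENNReal.ofReal (Real.exp ((∑ i, ∑ j, c i * c j * ∫ ω, Y i ω * Y j ω ∂P) / 2)) := by
  obtain ⟨v, hv⟩ := hG c
  have hLp (i : ι) : MemLp (Y i) 2 P := by
    obtain ⟨w, hw⟩ := hG (Pi.single i 1)
    refine memLp_two_of_map_eq_gaussianReal (hY i) (v := w) ?_
    rw [← hw]
    simp [Pi.single_apply]
  rw [lintegral_exp_of_map_eq_gaussianReal (by fun_prop) hv]
  congr 3
  have hint (i j : ι) : Integrable (fun ω => c i * c j * (Y i ω * Y j ω)) P :=
    ((hLp i).integrable_mul (hLp j)).const_mul _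
  simp_rw [← integral_const_mul]
  have : ∀ ω, (∑ i, c i * Y i ω) ^ 2 = ∑ i, ∑ j, c i * c j * (Y i ω * Y j ω) := fun ω => by
    rw [sq, Finset.sum_mul_sum]
    exact Finset.sum_congr rfl fun i _ => Finset.sum_congr rfl fun j _ => by ring
  simp_rw [this]
  rw [integral_finsetSum _ fun i _ => integrable_finsetSum _ fun j _ => hint i j]
  exact Finset.sum_congr rfl fun i _ => integral_finsetSum _ fun j _ => hint i j

lemma integral_sq_integral_le [SFinite P] {E : Type*} [MeasurableSpace E] {μ : Measure E}
    [SFinite μ] {f : E → Ω → ℝ} (hf : Measurable (Function.uncurry f)) {K : ℝ} (hK : 0 ≤ K)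
    (h : ∫⁻ x, ∫⁻ y, ∫⁻ ω, ‖f x ω‖ₑ * ‖f y ω‖ₑ ∂P ∂μ ∂μ ≤ ENNReal.ofReal K) :
    ∫ ω, (∫ x, f x ω ∂μ) ^ 2 ∂P ≤ K := by
  have hf' (ω : Ω) : Measurable fun x => f x ω := hf.comp (measurable_id.prodMk measurable_const)
  have hx (x : E) : Measurable (f x) := hf.comp (measurable_const.prodMk measurable_id)
  have key : ‖∫ ω, (∫ x, f x ω ∂μ) ^ 2 ∂P‖ₑ ≤ ENNReal.ofReal K := calc
    _ ≤ ∫⁻ ω, ‖(∫ x, f x ω ∂μ) ^ 2‖ₑ ∂P := enorm_integral_le_lintegral_enorm _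
    _ ≤ ∫⁻ ω, ∫⁻ x, ∫⁻ y, ‖f x ω‖ₑ * ‖f y ω‖ₑ ∂μ ∂μ ∂P := by
      refine lintegral_mono fun ω => ?_
      simp_rw [lintegral_const_mul _ (hf' ω).enorm, lintegral_mul_const _ (hf' ω).enorm]
      rw [enorm_pow, sq]
      gcongr <;> exact enorm_integral_le_lintegral_enorm _
    _ = ∫⁻ x, ∫⁻ y, ∫⁻ ω, ‖f x ω‖ₑ * ‖f y ω‖ₑ ∂P ∂μ ∂μ := by
      have m1 : Measurable fun p : (Ω × E) × E => ‖f p.1.2 p.1.1‖ₑ * ‖f p.2 p.1.1‖ₑ :=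
        ((hf.comp ((measurable_snd.comp measurable_fst).prodMk
          (measurable_fst.comp measurable_fst))).enorm).mul
          ((hf.comp (measurable_snd.prodMk (measurable_fst.comp measurable_fst))).enorm)
      rw [lintegral_lintegral_swap (m1.lintegral_prod_right' (ν := μ)).aemeasurable]
      refine lintegral_congr fun x => ?_
      refine lintegral_lintegral_swap (Measurable.aemeasurable ?_)
      exact m1.comp ((measurable_fst.prodMk measurable_const).prodMk measurable_snd)
    _ ≤ _ := h
  rw [Real.enorm_eq_ofReal_abs] at key
  exact (le_abs_self _).trans ((ENNReal.ofReal_le_ofReal_iff hK).1 key)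

lemma lintegral_enorm_mul_le_of_tilt [IsProbabilityMeasure P] {U₁ U₂ V₁ V₂ f₁ f₂ : Ω → ℝ}
    (hU₁ : Measurable U₁) (hU₂ : Measurable U₂) (hV₁ : Measurable V₁) (hV₂ : Measurable V₂)
    (hG : ∀ c : Fin 4 → ℝ, ∃ v : NNReal,
      P.map (fun ω => ∑ i, c i * ![U₁, U₂, V₁, V₂] i ω) = gaussianReal 0 v)
    {γ l A : ℝ}
    (h₁ : ∀ ω, |f₁ ω| ≤ Real.exp (γ * U₁ ω - γ ^ 2 / 2 * ∫ ω, U₁ ω ^ 2 ∂P + l * (A - V₁ ω)))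
    (h₂ : ∀ ω, |f₂ ω| ≤ Real.exp (γ * U₂ ω - γ ^ 2 / 2 * ∫ ω, U₂ ω ^ 2 ∂P + l * (A - V₂ ω))) :
    ∫⁻ ω, ‖f₁ ω‖ₑ * ‖f₂ ω‖ₑ ∂P ≤ ENNReal.ofReal (Real.exp
      (γ ^ 2 * ∫ ω, U₁ ω * U₂ ω ∂P
        + l ^ 2 / 2 * (∫ ω, V₁ ω * V₁ ω ∂P + ∫ ω, V₂ ω * V₂ ω ∂P + 2 * ∫ ω, V₁ ω * V₂ ω ∂P)
        - γ * l * (∫ ω, U₁ ω * V₁ ω ∂P + ∫ ω, U₂ ω * V₂ ω ∂P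
          + ∫ ω, U₁ ω * V₂ ω ∂P + ∫ ω, U₂ ω * V₁ ω ∂P) + 2 * l * A)) := by
  have hm : ∀ i, Measurable (![U₁, U₂, V₁, V₂] i) := by
    intro i; fin_cases i <;> assumption
  have key := lintegral_exp_linearCombination hm hG ![γ, γ, -l, -l]
  set κ := 2 * l * A - γ ^ 2 / 2 * ∫ ω, U₁ ω ^ 2 ∂P - γ ^ 2 / 2 * ∫ ω, U₂ ω ^ 2 ∂P with hκ
  calc
    _ ≤ ∫⁻ ω, ENNReal.ofReal (Real.exp κ) * ENNReal.ofReal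
          (Real.exp (∑ i, ![γ, γ, -l, -l] i * ![U₁, U₂, V₁, V₂] i ω)) ∂P := by
      refine lintegral_mono fun ω => ?_
      rw [Real.enorm_eq_ofReal_abs, Real.enorm_eq_ofReal_abs,
        ← ENNReal.ofReal_mul (abs_nonneg _), ← ENNReal.ofReal_mul (Real.exp_pos _).le]
      refine ENNReal.ofReal_le_ofReal
        ((mul_le_mul (h₁ ω) (h₂ ω) (abs_nonneg _) (Real.exp_pos _).le).trans_eq ?_)
      rw [← Real.exp_add, ← Real.exp_add, Fin.sum_univ_four]
      simp only [Matrix.cons_val]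
      rw [hκ]
      congr 1
      ring
    _ = _ := by
      rw [lintegral_const_mul' _ _ ENNReal.ofReal_ne_top, key,
        ← ENNReal.ofReal_mul (Real.exp_pos _).le, ← Real.exp_add]
      congr 2
      simp only [Fin.sum_univ_four, Matrix.cons_val]
      rw [hκ]
      have c₁ : ∫ ω, U₂ ω * U₁ ω ∂P = ∫ ω, U₁ ω * U₂ ω ∂P := by simp_rw [mul_comm]
      have c₂ : ∫ ω, V₁ ω * U₁ ω ∂P = ∫ ω, U₁ ω * V₁ ω ∂P := by simp_rw [mul_comm]
      have c₃ : ∫ ω, V₁ ω * U₂ ω ∂P = ∫ ω, U₂ ω * V₁ ω ∂P := by simp_rw [mul_comm]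
      have c₄ : ∫ ω, V₂ ω * U₁ ω ∂P = ∫ ω, U₁ ω * V₂ ω ∂P := by simp_rw [mul_comm]
      have c₅ : ∫ ω, V₂ ω * U₂ ω ∂P = ∫ ω, U₂ ω * V₂ ω ∂P := by simp_rw [mul_comm]
      have c₆ : ∫ ω, V₂ ω * V₁ ω ∂P = ∫ ω, V₁ ω * V₂ ω ∂P := by simp_rw [mul_comm]
      rw [c₁, c₂, c₃, c₄, c₅, c₆]
      simp_rw [sq (U₁ _), sq (U₂ _)]
      ring

end moments

lemma mul_add_le_of_abs_le {C ε c G M : ℝ} (hC : |C - 1| ≤ ε) (hε : ε ≤ 1) (hG : |G| ≤ M)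
    (hc : 0 ≤ c) : C * (c + G) ≤ (1 + ε) * c + 2 * M := by
  obtain ⟨h1, h2⟩ := abs_le.1 hC
  obtain ⟨h3, h4⟩ := abs_le.1 hG
  have h5 : C * G ≤ C * M := mul_le_mul_of_nonneg_left h4 (by linarith)
  have h6 : C * c ≤ (1 + ε) * c := mul_le_mul_of_nonneg_right (by linarith) hc
  nlinarith

lemma le_mul_add_of_abs_le {C ε c G M : ℝ} (hC : |C - 1| ≤ ε) (hε : ε ≤ 1) (hG : |G| ≤ M)
    (hc : 0 ≤ c) : (1 - ε) * c - 2 * M ≤ C * (c + G) := by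
  obtain ⟨h1, h2⟩ := abs_le.1 hC
  obtain ⟨h3, h4⟩ := abs_le.1 hG
  have h5 : C * (-M) ≤ C * G := mul_le_mul_of_nonneg_left h3 (by linarith)
  have h6 : (1 - ε) * c ≤ C * c := mul_le_mul_of_nonneg_right (by linarith) hc
  nlinarith

lemma exists_lintegral_rpow_norm_sub_le {d : ℕ} (hd : 1 ≤ d) {θ : ℝ} (hθ : θ < d)
    {D : Set (EuclideanSpace ℝ (Fin d))} (hDm : MeasurableSet D) (hD : Bornology.IsBounded D) :
    ∃ K : ℝ, 0 ≤ K ∧ ∀ x ∈ D,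
      ∫⁻ y in D, ENNReal.ofReal (1 + ‖x - y‖ ^ (-θ)) ≤ ENNReal.ofReal K := by
  obtain ⟨R, hR⟩ := hD.subset_ball 0
  have hfin : Module.finrank ℝ (EuclideanSpace ℝ (Fin d)) = d := by simp
  have hint : IntegrableOn (fun z : EuclideanSpace ℝ (Fin d) => 1 + ‖z‖ ^ (-θ))
      (Metric.ball 0 (2 * R)) := by
    refine Integrable.add (integrable_const_iff.2 (Or.inr ?_)) ?_
    · exact ⟨by simpa using measure_ball_lt_top⟩
    · refine integrableOn_ball_of_norm_le_rpow (C := 1) (α := θ) (by rw [hfin]; exact hd)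
        (by rw [hfin]; exact hθ) (ae_of_all _ fun z => ?_) (Measurable.aestronglyMeasurable
          (by fun_prop))
      rw [one_mul, Real.norm_of_nonneg (by positivity)]
  refine ⟨∫ z in Metric.ball (0 : EuclideanSpace ℝ (Fin d)) (2 * R), (1 + ‖z‖ ^ (-θ)),
    integral_nonneg fun z => by positivity, fun x hx => ?_⟩
  rw [ofReal_integral_eq_lintegral_ofReal hint (ae_of_all _ fun z => by positivity),
    ← lintegral_indicator Metric.isOpen_ball.measurableSet,
    ← lintegral_sub_left_eq_self (μ := volume) _ x, ← lintegral_indicator hDm]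
  refine lintegral_mono (indicator_le fun y hy => ?_)
  rw [indicator_of_mem]
  rw [mem_ball_zero_iff]
  have h1 := mem_ball_zero_iff.1 (hR hx)
  have h2 := mem_ball_zero_iff.1 (hR hy)
  linarith [norm_sub_le x y]

lemma crude_exponent_le {C ε G M H t T : ℝ} (hC : |C - 1| ≤ ε) (hε : ε ≤ 1) (hG : |G| ≤ M)
    (hH : 0 < H) (ht : t ≤ T) (hTM : 0 ≤ T + M) :
    C * ((1 - Real.exp (-(2 * (H * t)))) / (2 * H) + G) ≤ 2 * T + 2 * M := by
  obtain ⟨c1, c2⟩ := abs_le.1 hC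
  have h1 : (1 - Real.exp (-(2 * (H * t)))) / (2 * H) ≤ T := by
    rw [div_le_iff₀ (by positivity)]
    have := Real.add_one_le_exp (-(2 * (H * t)))
    nlinarith
  have h2 := (abs_le.1 hG).2
  have h3 := mul_le_mul_of_nonneg_left (add_le_add h1 h2) (by linarith : 0 ≤ C)
  have h4 : C * (T + M) ≤ 2 * (T + M) := mul_le_mul_of_nonneg_right (by linarith) hTM
  linarith

lemma crude_exponent_le_of_far {C ε G M H t : ℝ} (hC : |C - 1| ≤ ε) (hε : ε ≤ 1) (hG : |G| ≤ M)
    (hH : 0 < H) (ht : 0 < t) (ha : 5 / 8 < H * t) (γ : ℝ) :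
    γ ^ 2 * (C * ((1 - Real.exp (-(2 * (H * t)))) / (2 * H) + G))
      ≤ γ ^ 2 * ((1 + ε) * (t * (22857 / 40000)) + 2 * M) := by
  have hε0 : 0 ≤ ε := (abs_nonneg _).trans hC
  have h1 := one_sub_exp_neg_div_le (x := 2 * (H * t)) (by linarith)
  have h2 : (1 - Real.exp (-(2 * (H * t)))) / (2 * H)
      = t * ((1 - Real.exp (-(2 * (H * t)))) / (2 * (H * t))) := by field_simp
  have h3 : 0 ≤ (1 - Real.exp (-(2 * (H * t)))) / (2 * H) := by
    refine div_nonneg ?_ (by positivity)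
    rw [sub_nonneg, Real.exp_le_one_iff]
    linarith
  have h5 := mul_le_mul_of_nonneg_left h1 ht.le
  rw [← h2] at h5
  refine mul_le_mul_of_nonneg_left ((mul_add_le_of_abs_le hC hε hG h3).trans ?_) (sq_nonneg γ)
  linarith [mul_le_mul_of_nonneg_left h5 (by linarith : 0 ≤ 1 + ε)]

/-- The choice of the scale `1 / n` matching the distance `exp (-t)`. -/
lemma exists_scale {t Hb H γ ρ : ℝ} (hHb : 0 < Hb) (hH : 0 < H) (hHle : H ≤ Hb / 2) (hρ : 0 < ρ)
    (ht : 2 + 2 / Hb + 8 * γ ^ 2 / ρ ≤ t) (ha : H * t ≤ 5 / 8) :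
    ∃ n : ℕ, 0 < (n : ℝ) ∧ (n : ℝ) ≤ t ∧ 1 / (Hb - H) < n ∧ (n : ℝ) ≤ 1 / H ∧
      γ ^ 2 * (2 * (t / n - 1)) ≤ ρ / 4 := by
  have h1 : 0 < 2 / Hb := by positivity
  have h2 : 0 ≤ 8 * γ ^ 2 / ρ := by positivity
  have hnt : (⌊t⌋₊ : ℝ) ≤ t := Nat.floor_le (by linarith)
  have htn : t < ⌊t⌋₊ + 1 := Nat.lt_floor_add_one t
  set n : ℕ := ⌊t⌋₊
  have hn0 : (0 : ℝ) < n := by linarith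
  refine ⟨n, hn0, hnt, lt_of_le_of_lt ?_ (show 2 / Hb < n by linarith), ?_, ?_⟩
  · rw [div_le_div_iff₀ (by linarith) hHb]
    linarith
  · rw [le_div_iff₀ hH]
    nlinarith
  · have h3 : t / n - 1 ≤ 1 / n := by
      rw [sub_le_iff_le_add, div_le_iff₀ hn0, add_mul, one_div_mul_cancel hn0.ne']
      linarith
    have h4 : 8 * γ ^ 2 * (1 / n) ≤ ρ := by
      rw [mul_one_div, div_le_iff₀ hn0, mul_comm ρ]
      exact (div_le_iff₀ hρ).1 (by linarith)
    nlinarith [mul_le_mul_of_nonneg_left h3 (sq_nonneg γ)]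

set_option maxHeartbeats 1000000 in
theorem stmt_4
    {d : ℕ} (hd : 1 ≤ d)
    {Ω : Type} [MeasurableSpace Ω] (P : Measure Ω) [IsProbabilityMeasure P]
    (D : Set (EuclideanSpace ℝ (Fin d)))
    (hDopen : IsOpen D) (hDconn : IsConnected D) (hDbdd : Bornology.IsBounded D)
    (H₀ : ℝ) (hH₀ : H₀ ∈ Set.Ioo (0 : ℝ) (1/2))
    (X : ℝ → EuclideanSpace ℝ (Fin d) → Ω → ℝ)
    (hXmeas : Measurable fun p : ℝ × EuclideanSpace ℝ (Fin d) × Ω => X p.1 p.2.1 p.2.2)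
    (C : ℝ → ℝ → ℝ) (G : ℝ → ℝ → EuclideanSpace ℝ (Fin d) → EuclideanSpace ℝ (Fin d) → ℝ)
    (g : EuclideanSpace ℝ (Fin d) → EuclideanSpace ℝ (Fin d) → ℝ)
    (hCpos : ∀ H h : ℝ, H ∈ Set.Ioo 0 H₀ → h ∈ Set.Ioo 0 H₀ → 0 < C H h)
    (hGbdd : ∀ H h : ℝ, H ∈ Set.Ioo 0 H₀ → h ∈ Set.Ioo 0 H₀ →
      ∃ K : ℝ, ∀ x ∈ D, ∀ y ∈ D, |G H h x y| ≤ K)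
    (hgauss : ∀ (n : ℕ) (c : Fin n → ℝ) (Hs : Fin n → ℝ) (xs : Fin n → EuclideanSpace ℝ (Fin d)),
      (∀ i, Hs i ∈ Set.Ioo 0 H₀) → (∀ i, xs i ∈ D) →
      ∃ v : NNReal, P.map (fun ω => ∑ i, c i * X (Hs i) (xs i) ω) = gaussianReal 0 v)
    (hcov : ∀ H h : ℝ, H ∈ Set.Ioo 0 H₀ → h ∈ Set.Ioo 0 H₀ → ∀ x ∈ D, ∀ y ∈ D,
      ∫ ω, X H x ω * X h y ω ∂P =
        C H h * ((1 - ‖x - y‖ ^ (H + h)) / (H + h) + G H h x y))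
    (hA1 : ∀ ε > (0 : ℝ), ∃ η > (0 : ℝ), ∀ H h : ℝ,
      H ∈ Set.Ioo 0 (min η H₀) → h ∈ Set.Ioo 0 (min η H₀) → |C H h - 1| ≤ ε)
    (hgbdd : ∃ K : ℝ, ∀ x ∈ D, ∀ y ∈ D, |g x y| ≤ K)
    (hA2 : ∀ ε > (0 : ℝ), ∃ η > (0 : ℝ), ∀ H h : ℝ,
      H ∈ Set.Ioo 0 (min η H₀) → h ∈ Set.Ioo 0 (min η H₀) →
      ∀ x ∈ D, ∀ y ∈ D, |G H h x y - g x y| ≤ ε)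
    :
    ∃ γstar : ℝ, γstar > Real.sqrt (7 * d / 4) ∧
      ∀ γ ∈ Set.Ioo (0 : ℝ) γstar, ∃ α₀ > γ, ∀ α ∈ Set.Ioo γ α₀,
        ∃ Hb ∈ Set.Ioo (0 : ℝ) H₀, ∃ K : ℝ,
          ∀ H ∈ Set.Ioc (0 : ℝ) (Hb / 2),
            ∀ (A : Set (EuclideanSpace ℝ (Fin d))), A ⊆ D → MeasurableSet A →
              (∫ ω, (∫ x in A,
                  Set.indicator
                    {ω' | ∀ h ∈ {h : ℝ | ∃ n : ℕ, h = H + 1 / n ∧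
                        1 / (Hb - H) < (n : ℝ) ∧ (n : ℝ) ≤ 1 / H},
                      X h x ω' ≤ α / (h + H)}
                    (fun ω' => Real.exp (γ * X H x ω' -
                      γ ^ 2 / 2 * ∫ ω'', (X H x ω'') ^ 2 ∂P)) ω) ^ 2 ∂P) ≤ K := by
  
  obtain ⟨K₀, hK₀⟩ := hgbdd
  have hd0 : (0 : ℝ) < d := by exact_mod_cast hd
  refine ⟨√(d / (22857 / 40000)), Real.sqrt_lt_sqrt (by positivity) (by linarith), ?_⟩
  rintro γ ⟨hγ, hγlt⟩
  have hγd : γ ^ 2 * (22857 / 40000) < d := by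
    have := (Real.lt_sqrt hγ.le).1 hγlt
    rwa [lt_div_iff₀ (by norm_num)] at this
  set ρ : ℝ := d - γ ^ 2 * (22857 / 40000) with hρ
  have hρ0 : 0 < ρ := by linarith
  set l : ℝ := γ * (339 / 500) with hl
  have hl0 : 0 < l := by positivity
  refine ⟨γ + ρ / (8 * l), by simp only [gt_iff_lt, lt_add_iff_pos_right]; positivity, ?_⟩
  rintro α ⟨hα, hαlt⟩
  have hαl : 2 * l * (α - γ) ≤ ρ / 4 := by
    have : (α - γ) * (8 * l) < ρ := (lt_div_iff₀ (by positivity)).1 (by linarith)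
    linarith
  set ε : ℝ := min 1 (ρ / (4 * (γ ^ 2 + l ^ 2 + 4 * γ * l))) with hε
  have hε0 : 0 < ε := by positivity
  have hε1 : ε ≤ 1 := min_le_left _ _
  have hερ : ε * (γ ^ 2 + l ^ 2 + 4 * γ * l) ≤ ρ / 4 := by
    have : ε * (4 * (γ ^ 2 + l ^ 2 + 4 * γ * l)) ≤ ρ :=
      (le_div_iff₀ (by positivity)).1 (min_le_right _ _)
    linarith
  obtain ⟨η₁, hη₁, hC⟩ := hA1 ε hε0
  obtain ⟨η₂, hη₂, hG⟩ := hA2 1 one_pos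
  set M : ℝ := max K₀ 0 + 1 with hM
  have hM0 : 0 < M := by positivity
  have hH0 := hH₀.1
  set Hb : ℝ := min (min η₁ η₂) H₀ / 2 with hHb
  have hmin : 0 < min (min η₁ η₂) H₀ := lt_min (lt_min hη₁ hη₂) hH0
  have hHb0 : 0 < Hb := by positivity
  have hHb1 : Hb < min (min η₁ η₂) H₀ := by rw [hHb]; linarith
  have hHbH₀ : Hb < H₀ := hHb1.trans_le (min_le_right _ _)
  have hHbη₁ : Hb < η₁ := hHb1.trans_le ((min_le_left _ _).trans (min_le_left _ _))
  have hHbη₂ : Hb < η₂ := hHb1.trans_le ((min_le_left _ _).trans (min_le_right _ _))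
  have hC' : ∀ H h, H ∈ Ioo 0 Hb → h ∈ Ioo 0 Hb → |C H h - 1| ≤ ε := fun H h hH hh =>
    hC H h ⟨hH.1, lt_min (hH.2.trans hHbη₁) (hH.2.trans hHbH₀)⟩
      ⟨hh.1, lt_min (hh.2.trans hHbη₁) (hh.2.trans hHbH₀)⟩
  have hG' : ∀ H h, H ∈ Ioo 0 Hb → h ∈ Ioo 0 Hb → ∀ x ∈ D, ∀ y ∈ D, |G H h x y| ≤ M := by
    intro H h hH hh x hx y hy
    have h1 := hG H h ⟨hH.1, lt_min (hH.2.trans hHbη₂) (hH.2.trans hHbH₀)⟩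
      ⟨hh.1, lt_min (hh.2.trans hHbη₂) (hh.2.trans hHbH₀)⟩ x hx y hy
    have h2 := hK₀ x hx y hy
    calc |G H h x y| = |(G H h x y - g x y) + g x y| := by ring_nf
      _ ≤ |G H h x y - g x y| + |g x y| := abs_add_le _ _
      _ ≤ M := by rw [hM]; linarith [le_max_left K₀ 0]
  have hcov' : ∀ H h, H ∈ Ioo 0 Hb → h ∈ Ioo 0 Hb → ∀ x ∈ D, ∀ y ∈ D,
      ∫ ω, X H x ω * X h y ω ∂P =
        C H h * ((1 - ‖x - y‖ ^ (H + h)) / (H + h) + G H h x y) := fun H h hH hh =>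
    hcov H h ⟨hH.1, hH.2.trans hHbH₀⟩ ⟨hh.1, hh.2.trans hHbH₀⟩
  set T : ℝ := 2 + 2 / Hb + 8 * γ ^ 2 / ρ with hT
  set θ : ℝ := d - ρ / 4 with hθ
  set N : ℝ := M * (2 * γ ^ 2 + 4 * l ^ 2 + 8 * γ * l) + 2 * γ ^ 2 * T with hN
  have hT0 : 0 < T := by positivity
  obtain ⟨J, hJ0, hJ⟩ := exists_lintegral_rpow_norm_sub_le (d := d) hd (θ := θ)
    (by rw [hθ]; linarith) hDopen.measurableSet hDbdd
  have hXm (H : ℝ) (x : EuclideanSpace ℝ (Fin d)) : Measurable (X H x) :=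
    hXmeas.comp (measurable_const.prodMk (measurable_const.prodMk measurable_id))
  refine ⟨Hb, ⟨hHb0, hHbH₀⟩, Real.exp N * J * volume.real D, ?_⟩
  rintro H ⟨hH, hHle⟩ A hAD hA
  have hHI : H ∈ Ioo 0 Hb := ⟨hH, by linarith⟩
  set S : Set ℝ := {h : ℝ | ∃ n : ℕ, h = H + 1 / n ∧
    1 / (Hb - H) < (n : ℝ) ∧ (n : ℝ) ≤ 1 / H} with hS
  set f : EuclideanSpace ℝ (Fin d) → Ω → ℝ := fun x =>
    Set.indicator {ω' | ∀ h ∈ S, X h x ω' ≤ α / (h + H)}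
      (fun ω' => Real.exp (γ * X H x ω' - γ ^ 2 / 2 * ∫ ω'', (X H x ω'') ^ 2 ∂P)) with hf
  have hScount : S.Countable := by
    refine (countable_range fun n : ℕ => H + 1 / (n : ℝ)).mono ?_
    rintro h ⟨n, hn, -⟩
    exact ⟨n, hn.symm⟩
  have hXm' (h : ℝ) : Measurable fun p : EuclideanSpace ℝ (Fin d) × Ω => X h p.1 p.2 :=
    hXmeas.comp (measurable_const.prodMk measurable_id)
  have hfm : Measurable (Function.uncurry f) := by
    have h1 : Function.uncurry f = Set.indicator
        {p : EuclideanSpace ℝ (Fin d) × Ω | ∀ h ∈ S, X h p.1 p.2 ≤ α / (h + H)}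
        (fun p => Real.exp (γ * X H p.1 p.2 - γ ^ 2 / 2 * ∫ ω'', (X H p.1 ω'') ^ 2 ∂P)) := by
      ext ⟨x, ω⟩
      simp [Function.uncurry, hf, indicator]
    rw [h1]
    refine Measurable.indicator ?_ ?_
    · have h2 : Measurable fun x : EuclideanSpace ℝ (Fin d) => ∫ ω'', (X H x ω'') ^ 2 ∂P :=
        (StronglyMeasurable.integral_prod_right'
          (((hXm' H).pow_const 2).stronglyMeasurable)).measurable
      exact (((hXm' H).const_mul γ).sub ((h2.comp measurable_fst).const_mul _)).exp
    · simp only [ofPred_forall]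
      exact MeasurableSet.biInter hScount fun h _ =>
        measurableSet_le (hXm' h) measurable_const
  have hf0 (x : EuclideanSpace ℝ (Fin d)) (ω : Ω) : |f x ω| ≤
      Real.exp (γ * X H x ω - γ ^ 2 / 2 * ∫ ω'', (X H x ω'') ^ 2 ∂P) := by
    simp only [hf, indicator]
    split_ifs
    · rw [abs_of_pos (Real.exp_pos _)]
    · simpa using (Real.exp_pos _).le
  have hfS (x : EuclideanSpace ℝ (Fin d)) (ω : Ω) {h : ℝ} (hh : h ∈ S) : |f x ω| ≤
      Real.exp (γ * X H x ω - γ ^ 2 / 2 * ∫ ω'', (X H x ω'') ^ 2 ∂P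
        + l * (α / (h + H) - X h x ω)) := by
    simp only [hf, indicator]
    split_ifs with hω
    · rw [abs_of_pos (Real.exp_pos _)]
      refine Real.exp_le_exp.2 (le_add_of_nonneg_right (mul_nonneg hl0.le ?_))
      linarith [hω h hh]
    · simpa using (Real.exp_pos _).le
  have hG4 {h : ℝ} (hh : h ∈ Ioo 0 Hb) {x y : EuclideanSpace ℝ (Fin d)} (hx : x ∈ D) (hy : y ∈ D)
      (c : Fin 4 → ℝ) : ∃ v : NNReal,
      P.map (fun ω => ∑ i, c i * ![X H x, X H y, X h x, X h y] i ω) = gaussianReal 0 v := by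
    obtain ⟨v, hv⟩ := hgauss 4 c ![H, H, h, h] ![x, y, x, y]
      (by
        intro i
        have := hHI.2.trans hHbH₀
        have := hh.2.trans hHbH₀
        fin_cases i <;> simp [*, hh.1])
      (by intro i; fin_cases i <;> simp [*])
    refine ⟨v, ?_⟩
    rw [← hv]
    refine congrArg (fun L => P.map L) (funext fun ω => ?_)
    simp [Fin.sum_univ_four]
  have hkernel : ∀ x ∈ D, ∀ y ∈ D, x ≠ y → ∫⁻ ω, ‖f x ω‖ₑ * ‖f y ω‖ₑ ∂P ≤
      ENNReal.ofReal (Real.exp N) * ENNReal.ofReal (1 + ‖x - y‖ ^ (-θ)) := by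
    intro x hx y hy hxy
    have hr : 0 < ‖x - y‖ := norm_pos_iff.2 (sub_ne_zero.2 hxy)
    set t : ℝ := -Real.log ‖x - y‖ with ht
    have hpow (s : ℝ) : ‖x - y‖ ^ s = Real.exp (-(s * t)) := by
      rw [Real.rpow_def_of_pos hr, ht]; ring_nf
    have hexp : ‖x - y‖ ^ (-θ) = Real.exp (t * θ) := by rw [hpow]; ring_nf
    rw [← ENNReal.ofReal_mul (Real.exp_pos _).le, hexp]
    have hsuff {E : ℝ} (hE : E ≤ N ∨ E ≤ N + t * θ) :
        Real.exp E ≤ Real.exp N * (1 + Real.exp (t * θ)) := by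
      rcases hE with hE | hE
      · nlinarith only [Real.exp_le_exp.2 hE, Real.exp_pos N, Real.exp_pos (t * θ)]
      · have := Real.exp_le_exp.2 hE
        rw [Real.exp_add] at this
        nlinarith only [this, Real.exp_pos N, Real.exp_pos (t * θ)]
    have hk : ∫ ω, X H x ω * X H y ω ∂P =
        C H H * ((1 - Real.exp (-(2 * (H * t)))) / (2 * H) + G H H x y) := by
      rw [hcov' H H hHI hHI x hx y hy, hpow, ← two_mul, mul_assoc]
    have hCH := hC' H H hHI hHI
    have hGH := hG' H H hHI hHI x hx y hy
    by_cases hcase : T ≤ t ∧ H * t ≤ 5 / 8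
    · obtain ⟨htT, ha⟩ := hcase
      have ht0 : 0 < t := hT0.trans_le htT
      obtain ⟨n, hn0, hnt, hinv, hnH, hbρ⟩ := exists_scale hHb0 hH hHle hρ0 htT ha
      set h : ℝ := H + 1 / n with hh
      have hhS : h ∈ S := ⟨n, rfl, hinv, hnH⟩
      have hhI : h ∈ Ioo 0 Hb := by
        refine ⟨by positivity, ?_⟩
        have : 1 / (n : ℝ) < Hb - H := by
          rw [div_lt_comm₀ hn0 (by linarith)]
          exact hinv
        linarith
      refine (lintegral_enorm_mul_le_of_tilt (hXm H x) (hXm H y) (hXm h x) (hXm h y)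
        (hG4 hhI hx hy) (fun ω => hfS x ω hhS) (fun ω => hfS y ω hhS)).trans
        (ENNReal.ofReal_le_ofReal (hsuff (Or.inr ?_)))
      have ha0 : 0 < H * t := by positivity
      have hb1 : 1 ≤ t / n := (one_le_div hn0).2 hnt
      have hhh : h + h = 2 * (H * t + t / n) / t := by rw [hh]; field_simp; ring
      have hHh : H + h = (2 * (H * t) + t / n) / t := by rw [hh]; field_simp; ring
      have hhH : h + H = (2 * (H * t) + t / n) / t := by rw [add_comm, hHh]
      have hH2 : 2 * H = 2 * (H * t) / t := by field_simp
      have e1 : (0 : ℝ) ≤ 1 - Real.exp (-(2 * (H * t))) := by simp; positivity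
      have e2 : (0 : ℝ) ≤ 1 - Real.exp (-(2 * (H * t + t / n))) := by simp; positivity
      have e3 : (0 : ℝ) ≤ 1 - Real.exp (-(2 * (H * t) + t / n)) := by
        rw [sub_nonneg, Real.exp_le_one_iff]
        linarith
      have hz (s : ℝ) (hs : 0 < s) (z : EuclideanSpace ℝ (Fin d)) : ‖z - z‖ ^ s = 0 := by
        rw [sub_self, norm_zero, Real.zero_rpow hs.ne']
      have hv : ∀ z ∈ D, ∫ ω, X h z ω * X h z ω ∂P
          ≤ (1 + ε) * (1 / (2 * (H * t + t / n) / t)) + 2 * M := by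
        intro z hz'
        rw [hcov' h h hhI hhI z hz' z hz', hz _ (by linarith [hhI.1]), sub_zero, hhh]
        exact mul_add_le_of_abs_le (hC' h h hhI hhI) hε1 (hG' h h hhI hhI z hz' z hz')
          (by positivity)
      have hp : ∀ z ∈ D, (1 - ε) * (1 / ((2 * (H * t) + t / n) / t)) - 2 * M
          ≤ ∫ ω, X H z ω * X h z ω ∂P := by
        intro z hz'
        rw [hcov' H h hHI hhI z hz' z hz', hz _ (by linarith [hhI.1]), sub_zero, hHh]
        exact le_mul_add_of_abs_le (hC' H h hHI hhI) hε1 (hG' H h hHI hhI z hz' z hz')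
          (by positivity)
      have hw : ∫ ω, X h x ω * X h y ω ∂P ≤ (1 + ε) *
          ((1 - Real.exp (-(2 * (H * t + t / n)))) / (2 * (H * t + t / n) / t)) + 2 * M := by
        rw [hcov' h h hhI hhI x hx y hy, hpow, hhh, div_mul_cancel₀ _ ht0.ne']
        exact mul_add_le_of_abs_le (hC' h h hhI hhI) hε1 (hG' h h hhI hhI x hx y hy)
          (by positivity)
      have hq : ∀ z ∈ D, ∀ z' ∈ D, ‖z - z'‖ = ‖x - y‖ → (1 - ε) *
          ((1 - Real.exp (-(2 * (H * t) + t / n))) / ((2 * (H * t) + t / n) / t)) - 2 * M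
          ≤ ∫ ω, X H z ω * X h z' ω ∂P := by
        intro z hz z' hz' hzz
        rw [hcov' H h hHI hhI z hz z' hz', hzz, hpow, hHh, div_mul_cancel₀ _ ht0.ne']
        exact le_mul_add_of_abs_le (hC' H h hHI hhI) hε1 (hG' H h hHI hhI z hz z' hz')
          (by positivity)
      have hkb : ∫ ω, X H x ω * X H y ω ∂P
          ≤ (1 + ε) * ((1 - Real.exp (-(2 * (H * t)))) / (2 * (H * t) / t)) + 2 * M := by
        rw [hk, hH2]
        exact mul_add_le_of_abs_le hCH hε1 hGH (by positivity)
      rw [hhH]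
      refine (tilted_exponent_le (tilted_rate_le ha0 ha hb1) ha0 hb1 ht0 hε0.le hγ hα.le hkb
        (hv x hx) (hv y hy) hw (hp x hx) (hp y hy) (hq x hx y hy rfl)
        (hq y hy x hx (norm_sub_rev y x)) hl).trans ?_
      have h3 : γ ^ 2 * (22857 / 40000 + 2 * (t / n - 1)) + ε * (γ ^ 2 + l ^ 2 + 4 * γ * l)
          + 2 * l * (α - γ) ≤ θ := by
        linarith only [hθ, hρ, hbρ, hερ, hαl]
      have h4 := mul_le_mul_of_nonneg_left h3 ht0.le
      have h5 : 0 ≤ 2 * γ ^ 2 * T := by positivity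
      linarith only [hN, h4, h5]
    · have htriv := lintegral_enorm_mul_le_of_tilt (A := 0) (l := 0) (γ := γ)
        (hXm H x) (hXm H y) (hXm H x) (hXm H y) (hG4 hHI hx hy) (f₁ := f x) (f₂ := f y)
        (fun ω => by simpa using hf0 x ω) (fun ω => by simpa using hf0 y ω)
      refine htriv.trans (ENNReal.ofReal_le_ofReal (hsuff ?_))
      simp only [ne_eq, OfNat.ofNat_ne_zero, not_false_eq_true, zero_pow, zero_div, zero_mul,
        mul_zero, add_zero, sub_zero]
      have hN' : γ ^ 2 * (2 * T + 2 * M) ≤ N := by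
        rw [hN]
        have : 0 ≤ M * (4 * l ^ 2 + 8 * γ * l) := by positivity
        linarith
      by_cases htT : T ≤ t
      · right
        have ht0 : 0 < t := hT0.trans_le htT
        have ha : 5 / 8 < H * t := by
          by_contra! h
          exact hcase ⟨htT, h⟩
        rw [hk]
        refine (crude_exponent_le_of_far hCH hε1 hGH hH ht0 ha γ).trans ?_
        have h7 : ε * γ ^ 2 ≤ ρ / 4 :=
          (mul_le_mul_of_nonneg_left (by nlinarith only [mul_pos hγ hl0, sq_nonneg l]) hε0.le).trans hερ
        have h8 : γ ^ 2 * ((1 + ε) * (22857 / 40000)) ≤ θ := by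
          nlinarith only [hθ, hρ, h7, hε0, sq_nonneg γ]
        have h9 := mul_le_mul_of_nonneg_left h8 ht0.le
        have h10 : 0 ≤ γ ^ 2 * (2 * T) := by positivity
        linarith only [h9, h10, hN']
      · left
        refine (mul_le_mul_of_nonneg_left ?_ (sq_nonneg γ)).trans hN'
        rw [hk]
        exact crude_exponent_le hCH hε1 hGH hH (not_le.1 htT).le (by positivity)
  have : Nonempty (Fin d) := ⟨⟨0, hd⟩⟩
  have hDfin : volume D ≠ ⊤ := hDbdd.measure_lt_top.ne
  refine integral_sq_integral_le (μ := volume.restrict A) hfm (by positivity) ?_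
  have hinner : ∀ x ∈ A, ∫⁻ y in A, ∫⁻ ω, ‖f x ω‖ₑ * ‖f y ω‖ₑ ∂P
      ≤ ENNReal.ofReal (Real.exp N) * ENNReal.ofReal J := by
    intro x hx
    calc
      _ ≤ ∫⁻ y in A, ENNReal.ofReal (Real.exp N) * ENNReal.ofReal (1 + ‖x - y‖ ^ (-θ)) := by
        refine lintegral_mono_ae ?_
        filter_upwards [ae_restrict_mem hA, ae_restrict_of_ae (Measure.ae_ne volume x)]
          with y hy hyx
        exact hkernel x (hAD hx) y (hAD hy) hyx.symm
      _ ≤ ENNReal.ofReal (Real.exp N) * ∫⁻ y in D, ENNReal.ofReal (1 + ‖x - y‖ ^ (-θ)) := by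
        rw [lintegral_const_mul' _ _ ENNReal.ofReal_ne_top]
        gcongr
      _ ≤ _ := by
        gcongr
        exact hJ x (hAD hx)
  calc
    _ ≤ ∫⁻ _ in A, ENNReal.ofReal (Real.exp N) * ENNReal.ofReal J :=
      setLIntegral_mono' hA hinner
    _ ≤ ENNReal.ofReal (Real.exp N) * ENNReal.ofReal J * volume D := by
      rw [setLIntegral_const]
      gcongr
    _ = _ := by
      rw [ENNReal.ofReal_mul (by positivity), ENNReal.ofReal_mul (by positivity), measureReal_def,
        ENNReal.ofReal_toReal hDfin]
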